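/- Let N ≥ 1, α ∈ ℝ, m > 0, ω > 0, and let P : ℂ^N → ℂ be a homogeneous polynomial of degree d. Define, for x = (x₁,…,x_N) ∈ (ℝ²)^N with z_j = x_{j,1} + i x_{j,2}, the function ψ(x) := (∏_{1≤j<k≤N} |x_j − x_k|^{−α}) · conj(P(z₁,…,z_N)) · exp(−(mω/2) Σ_{j=1}^N |x_j|²). Then at every point x of (ℝ²)^N ∖ △△ one has Σ_{j=1}^N (1/(2m)) D_j² ψ(x) + (mω²/2)(Σ_{j=1}^N |x_j|²) ψ(x) = ω ( N + d − α N(N−1)/2 ) ψ(x); i.e., ψ is a generalized (singular) eigenfunction of the N-anyon harmonic oscillator Hamiltonian with eigenvalue ω(N + d − α N(N−1)/2). -/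

import Mathlib

open MeasureTheory Finset
open scoped BigOperators ComplexConjugate

noncomputable section

/-- Configuration space of `N` particles in the plane. -/
abbrev Conf (N : ℕ) := Fin N → Fin 2 → ℝ

/-- Euclidean norm of a planar vector. -/
def nrm (v : Fin 2 → ℝ) : ℝ := Real.sqrt (v 0 ^ 2 + v 1 ^ 2)

/-- Counterclockwise 90°-rotation `x^⊥ = (-x₂, x₁)`. -/
def perp (v : Fin 2 → ℝ) : Fin 2 → ℝ := ![-(v 1), v 0]

/-- Complex coordinate `z = x₁ + i x₂` of a planar point. -/
def zC (v : Fin 2 → ℝ) : ℂ := (v 0 : ℂ) + (v 1 : ℂ) * Complex.I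

/-- Standard basis vector labelled `(j,i)` of the configuration space. -/
def evec {N : ℕ} (j : Fin N) (i : Fin 2) : Conf N :=
  fun j' i' => if j' = j ∧ i' = i then 1 else 0

/-- Partial derivative in the variable `(j,i)` of a complex-valued function. -/
def pd {N : ℕ} (j : Fin N) (i : Fin 2) (f : Conf N → ℂ) (x : Conf N) : ℂ :=
  fderiv ℝ f x (evec j i)

/-- Partial derivative in the variable `(j,i)` of a real-valued function. -/
def pdR {N : ℕ} (j : Fin N) (i : Fin 2) (f : Conf N → ℝ) (x : Conf N) : ℝ :=
  fderiv ℝ f x (evec j i)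

/-- Ideal anyon magnetic potential `A_j(x) = Σ_{k≠j} (x_j - x_k)^{-⊥}`. -/
def Avec {N : ℕ} (j : Fin N) (x : Conf N) : Fin 2 → ℝ :=
  ∑ k ∈ univ.filter (fun k => k ≠ j), (1 / nrm (x j - x k) ^ 2) • perp (x j - x k)

/-- Component `i` of the magnetically coupled momentum `D_j = -i∇_j + αA_j`. -/
def Dop {N : ℕ} (α : ℝ) (j : Fin N) (i : Fin 2) (f : Conf N → ℂ) (x : Conf N) : ℂ :=
  (-Complex.I) * pd j i f x + ((α * Avec j x i : ℝ) : ℂ) * f x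

/-- The magnetic Laplacian `D_j² = D_j · D_j`. -/
def D2 {N : ℕ} (α : ℝ) (j : Fin N) (f : Conf N → ℂ) (x : Conf N) : ℂ :=
  ∑ i : Fin 2, Dop α j i (fun y => Dop α j i f y) x

/-- The fat diagonal of the configuration space. -/
def fatDiag (N : ℕ) : Set (Conf N) := {x | ∃ j k, j ≠ k ∧ x j = x k}


/-- `f` is differentiable at `x` with partial derivative `c` in the variable `(j,i)`. -/
def HP {N : ℕ} {E : Type} [NormedAddCommGroup E] [NormedSpace ℝ E] (j : Fin N) (i : Fin 2)
    (f : Conf N → E) (c : E) (x : Conf N) : Prop :=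
  ∃ f' : Conf N →L[ℝ] E, HasFDerivAt f f' x ∧ f' (evec j i) = c

section HPbasic
variable {N : ℕ} {j : Fin N} {i : Fin 2} {x : Conf N}

lemma HP.pd_eq {f : Conf N → ℂ} {c : ℂ} (h : HP j i f c x) : pd j i f x = c := by
  obtain ⟨f', h1, h2⟩ := h
  rw [pd, h1.fderiv, h2]

lemma HP.congr_val {E : Type} [NormedAddCommGroup E] [NormedSpace ℝ E]
    {f : Conf N → E} {c c' : E} (h : HP j i f c x) (hc : c = c') : HP j i f c' x := hc ▸ h

lemma HP.const {E : Type} [NormedAddCommGroup E] [NormedSpace ℝ E] (a : E) :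
    HP j i (fun _ : Conf N => a) 0 x :=
  ⟨0, hasFDerivAt_const _ _, rfl⟩

lemma HP.coord (k : Fin N) (l : Fin 2) :
    HP j i (fun y : Conf N => y k l) (if k = j ∧ l = i then 1 else 0) x := by
  refine ⟨(ContinuousLinearMap.proj (R := ℝ) (φ := fun _ : Fin 2 => ℝ) l).comp
      (ContinuousLinearMap.proj (R := ℝ) (φ := fun _ : Fin N => (Fin 2 → ℝ)) k), ?_, ?_⟩
  · exact ((ContinuousLinearMap.proj (R := ℝ) (φ := fun _ : Fin 2 => ℝ) l).comp
      (ContinuousLinearMap.proj (R := ℝ) (φ := fun _ : Fin N => (Fin 2 → ℝ)) k)).hasFDerivAt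
  · simp [evec]

lemma HP.add {E : Type} [NormedAddCommGroup E] [NormedSpace ℝ E]
    {f g : Conf N → E} {c e : E} (hf : HP j i f c x) (hg : HP j i g e x) :
    HP j i (fun y => f y + g y) (c + e) x := by
  obtain ⟨f', h1, h2⟩ := hf
  obtain ⟨g', h3, h4⟩ := hg
  exact ⟨f' + g', h1.add h3, by simp [h2, h4]⟩

lemma HP.sub {E : Type} [NormedAddCommGroup E] [NormedSpace ℝ E]
    {f g : Conf N → E} {c e : E} (hf : HP j i f c x) (hg : HP j i g e x) :
    HP j i (fun y => f y - g y) (c - e) x := by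
  obtain ⟨f', h1, h2⟩ := hf
  obtain ⟨g', h3, h4⟩ := hg
  exact ⟨f' - g', h1.sub h3, by simp [h2, h4]⟩

lemma HP.sum {E : Type} [NormedAddCommGroup E] [NormedSpace ℝ E] {ι : Type} (s : Finset ι)
    {f : ι → Conf N → E} {c : ι → E} (hf : ∀ k ∈ s, HP j i (f k) (c k) x) :
    HP j i (fun y => ∑ k ∈ s, f k y) (∑ k ∈ s, c k) x := by
  classical
  induction s using Finset.induction_on with
  | empty => simpa using HP.const (0 : E)
  | insert a s ha ih =>
    simp only [Finset.sum_insert ha]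
    exact (hf a (by simp)).add (ih fun k hk => hf k (by simp [hk]))

lemma HP.mul {A : Type} [NormedCommRing A] [NormedAlgebra ℝ A]
    {f g : Conf N → A} {c e : A} (hf : HP j i f c x) (hg : HP j i g e x) :
    HP j i (fun y => f y * g y) (c * g x + f x * e) x := by
  obtain ⟨f', h1, h2⟩ := hf
  obtain ⟨g', h3, h4⟩ := hg
  exact ⟨_, h1.mul h3, by simp [h2, h4]; ring⟩

lemma HP.const_mul {A : Type} [NormedCommRing A] [NormedAlgebra ℝ A]
    {f : Conf N → A} {c : A} (a : A) (hf : HP j i f c x) :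
    HP j i (fun y => a * f y) (a * c) x :=
  ((HP.const a).mul hf).congr_val (by ring)

lemma HP.clm {E F : Type} [NormedAddCommGroup E] [NormedSpace ℝ E]
    [NormedAddCommGroup F] [NormedSpace ℝ F] (L : E →L[ℝ] F)
    {f : Conf N → E} {c : E} (hf : HP j i f c x) :
    HP j i (fun y => L (f y)) (L c) x := by
  obtain ⟨f', h1, h2⟩ := hf
  exact ⟨L.comp f', L.hasFDerivAt.comp x h1, by simp [h2]⟩

lemma HP.ofReal {f : Conf N → ℝ} {c : ℝ} (hf : HP j i f c x) :
    HP j i (fun y => (f y : ℂ)) (c : ℂ) x := hf.clm Complex.ofRealCLM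

lemma HP.conj {f : Conf N → ℂ} {c : ℂ} (hf : HP j i f c x) :
    HP j i (fun y => conj (f y)) (conj c) x := hf.clm Complex.conjCLE.toContinuousLinearMap

lemma HP.inv {f : Conf N → ℂ} {c : ℂ} (hf : HP j i f c x) (h0 : f x ≠ 0) :
    HP j i (fun y => (f y)⁻¹) (-(f x ^ 2)⁻¹ * c) x := by
  obtain ⟨f', h1, h2⟩ := hf
  exact ⟨_, (hasDerivAt_inv h0).comp_hasFDerivAt x h1, by simp [h2]⟩

lemma HP.compR {f : Conf N → ℝ} {c : ℝ} {g : ℝ → ℝ} {g' : ℝ} (hf : HP j i f c x)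
    (hg : HasDerivAt g g' (f x)) : HP j i (fun y => g (f y)) (g' * c) x := by
  obtain ⟨f', h1, h2⟩ := hf
  exact ⟨_, hg.comp_hasFDerivAt x h1, by simp [h2]⟩

lemma HP.prod_log {ι : Type} (s : Finset ι)
    {f : ι → Conf N → ℝ} {c : ι → ℝ} (hf : ∀ k ∈ s, HP j i (f k) (c k * f k x) x) :
    HP j i (fun y => ∏ k ∈ s, f k y) ((∑ k ∈ s, c k) * ∏ k ∈ s, f k x) x := by
  classical
  induction s using Finset.induction_on with
  | empty => simpa using HP.const (1 : ℝ)
  | insert a s ha ih =>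
    simp only [Finset.prod_insert ha, Finset.sum_insert ha]
    exact ((hf a (by simp)).mul (ih fun k hk => hf k (by simp [hk]))).congr_val (by ring)

lemma nrm_sq (v : Fin 2 → ℝ) : nrm v ^ 2 = v 0 ^ 2 + v 1 ^ 2 :=
  Real.sq_sqrt (by positivity)

lemma nrm_pos {v : Fin 2 → ℝ} (h : v ≠ 0) : 0 < nrm v := by
  apply Real.sqrt_pos.2
  by_contra hc
  apply h
  have h0 : v 0 = 0 := by nlinarith [sq_nonneg (v 0), sq_nonneg (v 1)]
  have h1 : v 1 = 0 := by nlinarith [sq_nonneg (v 0), sq_nonneg (v 1)]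
  ext l; fin_cases l <;> simp [h0, h1]

/-- Kronecker delta. -/
def dl {N : ℕ} (a j : Fin N) : ℝ := if a = j then 1 else 0

lemma HP.usq (a b : Fin N) :
    HP j i (fun y : Conf N => nrm (y a - y b) ^ 2)
      (2 * ((dl a j - dl b j) * (x a i - x b i))) x := by
  simp only [nrm_sq, Pi.sub_apply]
  simp only [pow_two]
  have h (l : Fin 2) := (HP.coord (j := j) (i := i) (x := x) a l).sub (HP.coord b l)
  refine (((h 0).mul (h 0)).add ((h 1).mul (h 1))).congr_val ?_
  unfold dl
  by_cases ha : a = j <;> by_cases hb : b = j <;> fin_cases i <;> simp [ha, hb] <;> ring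

lemma HP.usq1 (a : Fin N) :
    HP j i (fun y : Conf N => nrm (y a) ^ 2) (2 * (dl a j * x a i)) x := by
  simp only [nrm_sq]
  simp only [pow_two]
  have h (l : Fin 2) := (HP.coord (j := j) (i := i) (x := x) a l)
  refine (((h 0).mul (h 0)).add ((h 1).mul (h 1))).congr_val ?_
  unfold dl
  by_cases ha : a = j <;> fin_cases i <;> simp [ha] <;> ring

lemma HP.pair (α : ℝ) (a b : Fin N) (h : x a ≠ x b) :
    HP j i (fun y : Conf N => nrm (y a - y b) ^ (-α))
      ((-α * ((dl a j - dl b j) * ((x a i - x b i) / nrm (x a - x b) ^ 2)))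
        * nrm (x a - x b) ^ (-α)) x := by
  have hp := nrm_pos (sub_ne_zero.2 h)
  have e : ∀ v, nrm v ^ (-α) = (nrm v ^ 2) ^ (-α / 2) := fun v => by
    rw [← Real.rpow_natCast, ← Real.rpow_mul (show 0 ≤ nrm v from Real.sqrt_nonneg _)]
    congr 1; push_cast; ring
  have h2 : 0 < nrm (x a - x b) ^ 2 := by positivity
  simp only [e]
  refine ((HP.usq a b).compR (Real.hasDerivAt_rpow_const (p := -α / 2) (Or.inl h2.ne'))).congr_val ?_
  rw [Real.rpow_sub_one h2.ne']
  field_simp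

end HPbasic

lemma fatDiag_ne {N : ℕ} {x : Conf N} (hx : x ∉ fatDiag N) {a b : Fin N} (h : a ≠ b) :
    x a ≠ x b := fun e => hx ⟨a, b, h, e⟩

lemma isOpen_offDiag (N : ℕ) : IsOpen {x : Conf N | x ∉ fatDiag N} := by
  have : {x : Conf N | x ∉ fatDiag N} =
      ⋂ a : Fin N, ⋂ b : Fin N, {x : Conf N | a ≠ b → x a ≠ x b} := by
    ext x; simp [fatDiag]
  rw [this]
  refine isOpen_iInter_of_finite fun a => isOpen_iInter_of_finite fun b => ?_
  by_cases h : a = b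
  · simp [h]
  · simp only [ne_eq, h, not_false_eq_true, forall_true_left]
    exact isOpen_ne_fun (continuous_apply a) (continuous_apply b)

/-- The real prefactor. -/
def V {N : ℕ} (α b : ℝ) (x : Conf N) : ℝ :=
  (∏ p ∈ univ.filter (fun p : Fin N × Fin N => p.1 < p.2), nrm (x p.1 - x p.2) ^ (-α))
    * Real.exp (-(b / 2) * ∑ j, nrm (x j) ^ 2)

/-- The radial vector field. -/
def R {N : ℕ} (j : Fin N) (x : Conf N) (i : Fin 2) : ℝ :=
  ∑ k ∈ univ.filter (fun k => k ≠ j), (x j i - x k i) / nrm (x j - x k) ^ 2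

lemma pair_sum {N : ℕ} (j : Fin N) (g : Fin N → Fin N → ℝ) (hg : ∀ a b, g a b = - g b a) :
    ∑ p ∈ univ.filter (fun p : Fin N × Fin N => p.1 < p.2), (dl p.1 j - dl p.2 j) * g p.1 p.2
      = ∑ k ∈ univ.filter (fun k => k ≠ j), g j k := by
  rw [Finset.sum_filter, Finset.sum_filter, Fintype.sum_prod_type]
  have e : ∀ a b : Fin N, (if a < b then (dl a j - dl b j) * g a b else 0)
      = (if a = j then (if a < b then g a b else 0) else 0)
        + (if b = j then (if a < b then g b a else 0) else 0) := by
    intro a b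
    unfold dl
    by_cases h : a < b
    · by_cases ha : a = j
      · have hb : b ≠ j := fun hb => by rw [ha, hb] at h; exact lt_irrefl _ h
        simp [h, ha, hb]
      · by_cases hb : b = j
        · simp only [h, ha, hb, if_true, if_false]
          rw [hg a j, if_pos (hb ▸ h)]
          simp [hb ▸ h]
        · simp [ha, hb]
    · simp [h]
  simp only [e, Finset.sum_add_distrib, Finset.sum_ite_eq', Finset.mem_univ, if_true]
  rw [Finset.sum_comm]
  simp only [Finset.sum_ite_eq', Finset.mem_univ, if_true]
  rw [← Finset.sum_add_distrib]
  refine Finset.sum_congr rfl fun k _ => ?_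
  rcases lt_trichotomy j k with h | h | h
  · simp [h, h.ne', h.not_gt]
  · simp [h]
  · simp [h, h.ne, h.not_gt]

lemma HP.V {N : ℕ} {j : Fin N} {i : Fin 2} {x : Conf N} (α b : ℝ) (hx : x ∉ fatDiag N) :
    HP j i (V α b) ((-α * R j x i - b * x j i) * V α b x) x := by
  have h1 := HP.prod_log (j := j) (i := i) (x := x)
    (univ.filter (fun p : Fin N × Fin N => p.1 < p.2))
    (f := fun p y => nrm (y p.1 - y p.2) ^ (-α)) (fun p hp => HP.pair α p.1 p.2
      (fatDiag_ne hx (by simpa using (Finset.mem_filter.1 hp).2.ne)))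
  have h2 := ((HP.sum (j := j) (i := i) (x := x) univ (f := fun a y => nrm (y a) ^ 2)
    (fun a _ => HP.usq1 a)).const_mul (-(b / 2))).compR (Real.hasDerivAt_exp _)
  refine (h1.mul h2).congr_val ?_
  rw [← Finset.mul_sum, pair_sum j (fun a b => (x a i - x b i) / nrm (x a - x b) ^ 2)]
  · simp only [R, _root_.V, ← Finset.mul_sum, dl, ite_mul, one_mul, zero_mul,
      Finset.sum_ite_eq', Finset.mem_univ, if_true]
    ring
  · intro a b
    rw [nrm_sq, nrm_sq, ← neg_div]
    congr 1 <;> simp <;> ring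

/-- coefficient of an antiholomorphic derivative -/
def cc (i : Fin 2) : ℂ := if i = 0 then 1 else -Complex.I

lemma HP.zbar {N : ℕ} {j : Fin N} {i : Fin 2} {x : Conf N} (k : Fin N) :
    HP j i (fun y : Conf N => conj (zC (y k))) (cc i * (dl k j : ℂ)) x := by
  have h (l : Fin 2) := (HP.coord (j := j) (i := i) (x := x) k l).ofReal
  refine ((h 0).add ((h 1).mul (HP.const Complex.I))).conj.congr_val ?_
  unfold dl cc
  by_cases hk : k = j <;> fin_cases i <;> simp [hk]

lemma HP.poly {N : ℕ} {j : Fin N} {i : Fin 2} {x : Conf N} (P : MvPolynomial (Fin N) ℂ) :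
    HP j i (fun y : Conf N => conj (MvPolynomial.eval (fun k => zC (y k)) P))
      (cc i * conj (MvPolynomial.eval (fun k => zC (x k)) (MvPolynomial.pderiv j P))) x := by
  induction P using MvPolynomial.induction_on with
  | C a => simpa using HP.const (conj a)
  | add p q hp hq =>
    simp only [map_add]
    exact (hp.add hq).congr_val (by ring)
  | mul_X p k hp =>
    simp only [map_mul, MvPolynomial.eval_X]
    refine (hp.mul (HP.zbar k)).congr_val ?_
    rw [MvPolynomial.pderiv_mul, MvPolynomial.pderiv_X]
    by_cases hk : k = j
    · subst hk; simp [dl]; ring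
    · simp [dl, hk]; ring

/-- Antiholomorphic field. -/
def S {N : ℕ} (j : Fin N) (x : Conf N) : ℂ :=
  ∑ k ∈ univ.filter (fun k => k ≠ j), (conj (zC (x j)) - conj (zC (x k)))⁻¹

lemma conj_mul_zC (v w : Fin 2 → ℝ) : (conj (zC v) - conj (zC w)) * (zC v - zC w)
    = ((nrm (v - w) ^ 2 : ℝ) : ℂ) := by
  rw [nrm_sq]; simp [zC]
  linear_combination (-((v 1 : ℂ) - w 1) ^ 2) * Complex.I_sq

lemma conj_ne {v w : Fin 2 → ℝ} (h : v ≠ w) : conj (zC v) - conj (zC w) ≠ 0 := by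
  intro h0
  have := conj_mul_zC v w
  rw [h0, zero_mul] at this
  have h1 := nrm_pos (sub_ne_zero.2 h)
  have h2 : nrm (v - w) ^ 2 = 0 := by exact_mod_cast this.symm
  exact (pow_pos h1 2).ne' h2

lemma HP.S {N : ℕ} {j : Fin N} {x : Conf N} (hx : x ∉ fatDiag N) :
    ∃ s : ℂ, ∀ i, HP j i (S j) (cc i * s) x := by
  refine ⟨∑ k ∈ univ.filter (fun k => k ≠ j),
    (-((conj (zC (x j)) - conj (zC (x k))) ^ 2)⁻¹), fun i => ?_⟩
  have := HP.sum (j := j) (i := i) (x := x) (univ.filter (fun k => k ≠ j)) (fun k hk =>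
    ((HP.zbar (j := j) (i := i) (x := x) j).sub (HP.zbar k)).inv
      (conj_ne (fatDiag_ne hx (Finset.mem_filter.1 hk).2.symm)))
  refine this.congr_val ?_
  rw [Finset.mul_sum]
  refine Finset.sum_congr rfl fun k hk => ?_
  have := (Finset.mem_filter.1 hk).2
  simp [dl, this]
  ring

lemma A_R {N : ℕ} {j : Fin N} {x : Conf N} (i : Fin 2) (hx : x ∉ fatDiag N) :
    (Avec j x i : ℂ) + Complex.I * (R j x i : ℂ) = Complex.I * cc i * S j x := by
  simp only [Avec, R, S, Finset.sum_apply, Complex.ofReal_sum, Finset.mul_sum]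
  rw [← Finset.sum_add_distrib]
  refine Finset.sum_congr rfl fun k hk => ?_
  have hne := fatDiag_ne hx (Finset.mem_filter.1 hk).2.symm
  have h0 := conj_ne hne
  have hn : ((nrm (x j - x k) ^ 2 : ℝ) : ℂ) ≠ 0 := by
    exact_mod_cast (pow_pos (nrm_pos (sub_ne_zero.2 hne)) 2).ne'
  have hinv : (conj (zC (x j)) - conj (zC (x k)))⁻¹
      = (zC (x j) - zC (x k)) / ((nrm (x j - x k) ^ 2 : ℝ) : ℂ) := by
    rw [← conj_mul_zC] at hn ⊢
    have := right_ne_zero_of_mul hn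
    field_simp
  rw [hinv]
  push_cast at hn ⊢
  have I2 := Complex.I_sq
  fin_cases i
  · simp [perp, cc, zC]
    linear_combination (-((x j 1 : ℂ) - x k 1)) * ((nrm (x j - x k) : ℂ)⁻¹) ^ 2 * I2
  · simp [perp, cc, zC]
    field_simp
    ring

lemma HP.dop {N : ℕ} {j : Fin N} {i : Fin 2} {x : Conf N} {α b : ℝ} {F : Conf N → ℂ} {c : ℂ}
    (hx : x ∉ fatDiag N) (hF : HP j i F c x) :
    Dop α j i (fun y => (_root_.V α b y : ℂ) * F y) x
      = (_root_.V α b x : ℂ) * (-Complex.I * c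
        + Complex.I * (b * x j i + α * (cc i * _root_.S j x)) * F x) := by
  rw [Dop, ((HP.V α b hx).ofReal.mul hF).pd_eq]
  have := A_R (j := j) i hx
  push_cast
  linear_combination (α * _root_.V α b x * F x : ℂ) * this

/-- First-order factor. -/
def F1 {N : ℕ} (α b : ℝ) (P : MvPolynomial (Fin N) ℂ) (j : Fin N) (i : Fin 2) (x : Conf N) : ℂ :=
  (-Complex.I * cc i) * (conj (MvPolynomial.eval (fun k => zC (x k)) (MvPolynomial.pderiv j P))
      - α * (S j x * conj (MvPolynomial.eval (fun k => zC (x k)) P)))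
    + (Complex.I * b) * ((x j i : ℂ) * conj (MvPolynomial.eval (fun k => zC (x k)) P))

lemma D2_eq {N : ℕ} {j : Fin N} {x : Conf N} {α b : ℝ} (P : MvPolynomial (Fin N) ℂ)
    (hx : x ∉ fatDiag N) :
    D2 α j (fun y => (V α b y : ℂ) * conj (MvPolynomial.eval (fun k => zC (y k)) P)) x
      = (V α b x : ℂ) *
        (2 * b * (conj (MvPolynomial.eval (fun k => zC (x k)) P)
          + conj (zC (x j)) *
            conj (MvPolynomial.eval (fun k => zC (x k)) (MvPolynomial.pderiv j P))
          - α * (conj (zC (x j)) * S j x) * conj (MvPolynomial.eval (fun k => zC (x k)) P))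
        - b ^ 2 * ((nrm (x j) ^ 2 : ℝ) : ℂ)
          * conj (MvPolynomial.eval (fun k => zC (x k)) P)) := by
  obtain ⟨s, hs⟩ := HP.S (j := j) hx
  have hD : ∀ i, Dop α j i (fun y => Dop α j i
      (fun y => (V α b y : ℂ) * conj (MvPolynomial.eval (fun k => zC (y k)) P)) y) x
      = Dop α j i (fun y => (V α b y : ℂ) * F1 α b P j i y) x := by
    intro i
    have : (fun y => Dop α j i
      (fun y => (V α b y : ℂ) * conj (MvPolynomial.eval (fun k => zC (y k)) P)) y)
      =ᶠ[nhds x] (fun y => (V α b y : ℂ) * F1 α b P j i y) := by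
      filter_upwards [(isOpen_offDiag N).mem_nhds hx] with y hy
      rw [HP.dop hy (HP.poly P), F1]
      ring
    have h0 := this.eq_of_nhds
    rw [Dop, pd, this.fderiv_eq, h0, Dop, pd]
  have hF : ∀ i, HP j i (F1 α b P j i) _ x := fun i =>
    (((HP.poly (i := i) (x := x) (MvPolynomial.pderiv j P)).sub
      (((hs i).mul (HP.poly P)).const_mul (α : ℂ))).const_mul (-Complex.I * cc i)).add
      (((HP.coord j i).ofReal.mul (HP.poly P)).const_mul (Complex.I * b))
  rw [D2, Fin.sum_univ_two, hD, hD, HP.dop hx (hF 0), HP.dop hx (hF 1), nrm_sq]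
  simp only [F1, cc]
  simp [zC]
  ring_nf
  simp only [Complex.I_sq, show Complex.I ^ 3 = -Complex.I by rw [pow_succ, Complex.I_sq]; ring,
    Complex.I_pow_four]
  ring

lemma sum_zS {N : ℕ} {x : Conf N} (hx : x ∉ fatDiag N) :
    ∑ j, conj (zC (x j)) * S j x = (N : ℂ) * (N - 1) / 2 := by
  have h1 : ∑ j, conj (zC (x j)) * S j x = ∑ j, ∑ k,
      if k ≠ j then conj (zC (x j)) * (conj (zC (x j)) - conj (zC (x k)))⁻¹ else 0 := by
    simp only [S, Finset.mul_sum, Finset.sum_filter, mul_ite, mul_zero]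
  have h2 := h1
  rw [Finset.sum_comm] at h2
  have h3 : 2 * ∑ j, conj (zC (x j)) * S j x = ∑ j : Fin N, ∑ k : Fin N,
      if k ≠ j then (1 : ℂ) else 0 := by
    rw [two_mul]
    nth_rewrite 1 [h1]
    rw [h2]
    simp only [← Finset.sum_add_distrib]
    refine Finset.sum_congr rfl fun j _ => Finset.sum_congr rfl fun k _ => ?_
    by_cases h : k = j
    · simp [h]
    · have e1 := conj_ne (fatDiag_ne hx h)
      have e2 := conj_ne (fatDiag_ne hx (Ne.symm h))
      simp only [ne_eq, h, Ne.symm h, not_false_eq_true, if_true]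
      rw [← neg_sub (conj (zC (x j)))] at e1 ⊢
      rw [inv_neg]
      field_simp
      ring
  have h4 : ∀ j : Fin N, (∑ k : Fin N, if k ≠ j then (1 : ℂ) else 0) = N - 1 := by
    intro j
    have : ∀ k : Fin N, (if k ≠ j then (1 : ℂ) else 0) = 1 - if k = j then 1 else 0 := by
      intro k; split_ifs <;> simp_all
    simp [this]
  simp only [h4] at h3
  simp at h3
  linear_combination h3 / 2

/-- For a homogeneous polynomial `P` of degree `d`, the function
`ψ = ∏_{j<k}|x_j-x_k|^{-α} · conj(P(z)) · e^{-(mω/2)Σ|x_j|²}` is a generalized (singular)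
eigenfunction of the `N`-anyon harmonic oscillator Hamiltonian away from the fat diagonal,
with eigenvalue `ω(N + d - αN(N-1)/2)`. -/
theorem statement11 (N : ℕ) (hN : 1 ≤ N) (α m ω : ℝ) (hm : 0 < m) (hω : 0 < ω)
    (d : ℕ) (P : MvPolynomial (Fin N) ℂ) (hP : P.IsHomogeneous d)
    (ψ : Conf N → ℂ)
    (hψdef : ψ = fun x =>
      ((∏ p ∈ univ.filter (fun p : Fin N × Fin N => p.1 < p.2),
          nrm (x p.1 - x p.2) ^ (-α) : ℝ) : ℂ)
        * conj (MvPolynomial.eval (fun j => zC (x j)) P)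
        * ((Real.exp (-(m * ω / 2) * ∑ j, nrm (x j) ^ 2) : ℝ) : ℂ)) :
    ∀ x : Conf N, x ∉ fatDiag N →
      ∑ j, ((1 / (2 * m) : ℝ) : ℂ) * D2 α j ψ x
          + (((m * ω ^ 2 / 2) * ∑ j, nrm (x j) ^ 2 : ℝ) : ℂ) * ψ x
        = ((ω * ((N : ℝ) + (d : ℝ) - α * (N : ℝ) * ((N : ℝ) - 1) / 2) : ℝ) : ℂ)
            * ψ x := by
  intro x hx
  have hψ : ψ = fun y => (V α (m * ω) y : ℂ)
      * conj (MvPolynomial.eval (fun k => zC (y k)) P) := by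
    rw [hψdef]; funext y
    rw [V]; push_cast; ring
  have hE : ∑ j, conj (zC (x j)) *
      conj (MvPolynomial.eval (fun k => zC (x k)) (MvPolynomial.pderiv j P))
      = d * conj (MvPolynomial.eval (fun k => zC (x k)) P) := by
    have := congrArg (fun q => conj (MvPolynomial.eval (fun k => zC (x k)) q)) hP.sum_X_mul_pderiv
    simpa using this
  have hS := sum_zS hx
  rw [hψ]
  simp only [D2_eq P hx]
  rw [← Finset.mul_sum, ← Finset.mul_sum, Finset.sum_sub_distrib, ← Finset.mul_sum,
    Finset.sum_sub_distrib, Finset.sum_add_distrib, hE, ← Finset.sum_mul, ← Finset.sum_mul,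
    ← Finset.mul_sum, ← Finset.mul_sum, hS]
  have hm' : (m : ℂ) ≠ 0 := by exact_mod_cast hm.ne'
  simp only [Finset.sum_const, Finset.card_univ, Fintype.card_fin, nsmul_eq_mul]
  push_cast
  field_simp
  ring
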